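/- Let A be a simple purely infinite C*-algebra. Then A is of type III: the lattice 𝒫 of annihilators of A is purely nonmodular, i.e. 𝒫 contains no nonzero modular annihilator. -/

import Mathlib

variable {A : Type*}

/-- The annihilator of a set `S`: elements anticommuting with every member of `S`. -/
def Ann [NonUnitalNonAssocRing A] (S : Set A) : Set A :=
  {a : A | ∀ s ∈ S, a * s + s * a = 0}

/-- The relative annihilator of `S` in `B`. -/
def AnnIn [NonUnitalNonAssocRing A] (B S : Set A) : Set A :=
  {a ∈ B | ∀ s ∈ S, a * s + s * a = 0}

/-- The set `𝒫` of annihilators of `A`. -/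
def PAnn (A : Type*) [NonUnitalNonAssocRing A] [PartialOrder A] : Set (Set A) :=
  {V | ∃ S : Set A, (∀ s ∈ S, 0 ≤ s) ∧ V = Ann (Ann S)}

/-- The set `𝒫_B` of relative annihilators in `B`. -/
def PAnnIn [NonUnitalNonAssocRing A] [PartialOrder A] (B : Set A) : Set (Set A) :=
  {V | ∃ S : Set A, S ⊆ B ∧ (∀ s ∈ S, 0 ≤ s) ∧ V = AnnIn B (AnnIn B S)}

/-- `V` is the least upper bound of the family `T` within the collection `P` (ordered by `⊆`). -/
def IsLUBIn {α : Type*} (P T : Set (Set α)) (V : Set α) : Prop :=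
  V ∈ P ∧ (∀ W ∈ T, W ⊆ V) ∧ ∀ U ∈ P, (∀ W ∈ T, W ⊆ U) → V ⊆ U

/-- `V` is the greatest lower bound of the family `T` within the collection `P`. -/
def IsGLBIn {α : Type*} (P T : Set (Set α)) (V : Set α) : Prop :=
  V ∈ P ∧ (∀ W ∈ T, V ⊆ W) ∧ ∀ U ∈ P, (∀ W ∈ T, U ⊆ W) → U ⊆ V

/-- The collection `P` of sets is a modular lattice (with respect to inclusion). -/
def ModularLat {α : Type*} (P : Set (Set α)) : Prop :=
  ∀ X ∈ P, ∀ Y ∈ P, ∀ Z ∈ P, X ⊆ Z →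
    ∀ m r₁ j r₂ : Set α, IsGLBIn P {Y, Z} m → IsLUBIn P {X, m} r₁ →
      IsLUBIn P {X, Y} j → IsGLBIn P {j, Z} r₂ → r₁ = r₂

/-- A projection in a *-ring. -/
def IsProjection [NonUnitalNonAssocRing A] [StarRing A] (p : A) : Prop :=
  p * p = p ∧ star p = p

/-- Murray–von Neumann equivalence of projections. -/
def MvNEquiv [NonUnitalNonAssocRing A] [StarRing A] (p q : A) : Prop :=
  ∃ x : A, x * star x = p ∧ star x * x = q

/-- A projection is infinite if it is equivalent to a proper subprojection of itself. -/
def IsInfiniteProjection [NonUnitalNonAssocRing A] [StarRing A] (p : A) : Prop :=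
  ∃ q : A, IsProjection q ∧ q * p = q ∧ p * q = q ∧ q ≠ p ∧ MvNEquiv p q

/-- `A` is simple: it has no nonzero proper closed two-sided ideals. -/
def IsSimpleCStar (A : Type*) [NonUnitalNormedRing A] : Prop :=
  ∀ I : TwoSidedIdeal A, IsClosed (I : Set A) → I = ⊥ ∨ I = ⊤

/-- A hereditary C*-subalgebra of `A`: a norm-closed *-subalgebra `B` such that
`0 ≤ x ≤ b` and `b ∈ B` imply `x ∈ B`. -/
def IsHereditarySub [NonUnitalCStarAlgebra A] [PartialOrder A] (B : Set A) : Prop :=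
  (∃ C : NonUnitalStarSubalgebra ℂ A, (C : Set A) = B) ∧ IsClosed B ∧
    ∀ b ∈ B, ∀ x : A, 0 ≤ x → x ≤ b → x ∈ B

/-- A simple C*-algebra is purely infinite if every nonzero hereditary C*-subalgebra contains
an infinite projection. -/
def IsPurelyInfinite (A : Type*) [NonUnitalCStarAlgebra A] [PartialOrder A] : Prop :=
  ∀ B : Set A, IsHereditarySub B → B ≠ {0} →
    ∃ p ∈ B, IsProjection p ∧ IsInfiniteProjection p

section Galois

variable [NonUnitalNonAssocRing A] {B S T : Set A}

lemma Ann_eq_AnnIn_univ (S : Set A) : Ann S = AnnIn Set.univ S := by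
  ext a; simp [Ann, AnnIn]

lemma AnnIn_subset : AnnIn B S ⊆ B := fun _ h ↦ h.1

lemma AnnIn_antitone (h : S ⊆ T) : AnnIn B T ⊆ AnnIn B S :=
  fun _ ha ↦ ⟨ha.1, fun s hs ↦ ha.2 s (h hs)⟩

lemma subset_AnnIn_AnnIn (h : S ⊆ B) : S ⊆ AnnIn B (AnnIn B S) :=
  fun s hs ↦ ⟨h hs, fun a ha ↦ by rw [add_comm]; exact ha.2 s hs⟩

lemma AnnIn_triple_subset (h : S ⊆ B) : AnnIn B (AnnIn B (AnnIn B S)) ⊆ AnnIn B S :=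
  AnnIn_antitone (subset_AnnIn_AnnIn h)

lemma isLUBIn_pair_of_subset {α : Type*} {P : Set (Set α)} {X m : Set α} (hX : X ∈ P)
    (hm : m ⊆ X) : IsLUBIn P {X, m} X :=
  ⟨hX, by simpa using hm, fun U _ h ↦ h X (by simp)⟩

lemma isGLBIn_pair_of_subset {α : Type*} {P : Set (Set α)} {j Z : Set α} (hZ : Z ∈ P)
    (hj : Z ⊆ j) : IsGLBIn P {j, Z} Z :=
  ⟨hZ, by simpa using hj, fun U _ h ↦ h Z (by simp)⟩

lemma isGLBIn_pair_inter {α : Type*} {P : Set (Set α)} {Y Z : Set α} (h : Y ∩ Z ∈ P) :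
    IsGLBIn P {Y, Z} (Y ∩ Z) :=
  ⟨h, by simp, fun U _ hU ↦ Set.subset_inter (hU Y (by simp)) (hU Z (by simp))⟩

/-- The biannihilator of a union is the join of the biannihilators. -/
lemma isLUBIn_AnnIn_union [PartialOrder A] (hS : S ⊆ B) (hT : T ⊆ B)
    (hS0 : ∀ s ∈ S, 0 ≤ s) (hT0 : ∀ s ∈ T, 0 ≤ s) :
    IsLUBIn (PAnnIn B) {AnnIn B (AnnIn B S), AnnIn B (AnnIn B T)}
      (AnnIn B (AnnIn B (S ∪ T))) := by
  refine ⟨⟨S ∪ T, Set.union_subset hS hT, ?_, rfl⟩, ?_, ?_⟩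
  · rintro s (h | h)
    exacts [hS0 s h, hT0 s h]
  · rintro W (rfl | rfl)
    exacts [AnnIn_antitone (AnnIn_antitone Set.subset_union_left),
      AnnIn_antitone (AnnIn_antitone Set.subset_union_right)]
  · rintro U ⟨R, hR, -, rfl⟩ h
    have h1 := (subset_AnnIn_AnnIn hS).trans (h _ (by simp))
    have h2 := (subset_AnnIn_AnnIn hT).trans (h _ (by simp))
    exact (AnnIn_antitone (AnnIn_antitone (Set.union_subset h1 h2))).trans
      (AnnIn_triple_subset AnnIn_subset)

end Galois

section CStar

variable [NonUnitalCStarAlgebra A]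

lemma eq_zero_of_star_mul_self {d : A} (h : star d * d = 0) : d = 0 :=
  (CStarRing.star_mul_self_eq_zero_iff d).1 h

lemma eq_zero_of_mul_star_self {d : A} (h : d * star d = 0) : d = 0 :=
  (CStarRing.mul_star_self_eq_zero_iff d).1 h

lemma mul_eq_zero_of_mul_mul_star {b c : A} (h : b * (c * star c) = 0) : b * c = 0 := by
  apply eq_zero_of_mul_star_self
  rw [star_mul, ← mul_assoc, mul_assoc b, h, zero_mul]

/-- If `z` is a projection and `a` is orthogonal to everything orthogonal to `z`, then `z`
is a left unit for `a`. -/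
lemma projection_mul_of_orthogonal (C : NonUnitalStarSubalgebra ℂ A) {z a : A}
    (hz : IsProjection z) (hzC : z ∈ C) (haC : a ∈ C)
    (h : ∀ u ∈ C, u * z = 0 → z * u = 0 → u * a = 0) : z * a = a := by
  obtain ⟨hz1, hz2⟩ := hz
  set u := a - z * a with hu
  have huC : u ∈ C := sub_mem haC (mul_mem hzC haC)
  have hzu : z * u = 0 := by rw [hu, mul_sub, ← mul_assoc, hz1, sub_self]
  have hstar : star u * z = 0 := by
    have := congrArg star hzu
    rwa [star_mul, hz2, star_zero] at this
  have h1 : u * star u * a = 0 := h _ (mul_mem huC (star_mem huC))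
    (by rw [mul_assoc, hstar, mul_zero]) (by rw [← mul_assoc, hzu, zero_mul])
  have h2 : star u * a = 0 := by
    apply eq_zero_of_star_mul_self
    rw [star_mul, star_star, mul_assoc, ← mul_assoc u, h1, mul_zero]
  have h3 : u = 0 := by
    apply eq_zero_of_star_mul_self
    nth_rewrite 2 [hu]
    rw [mul_sub, h2, ← mul_assoc, hstar, zero_mul, sub_zero]
  exact (sub_eq_zero.1 (hu ▸ h3)).symm

variable [PartialOrder A] [StarOrderedRing A]

/-- An element anticommuting with a positive element is orthogonal to it. -/
lemma mul_eq_zero_of_anticommute {a s : A} (hs : 0 ≤ s) (h : a * s + s * a = 0) :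
    a * s = 0 ∧ s * a = 0 := by
  have h1 : a * s = -(s * a) := eq_neg_of_add_eq_zero_left h
  have hc : Commute (s * s) a := by
    change s * s * a = a * (s * s)
    rw [← mul_assoc, h1, neg_mul, mul_assoc s a s, h1, mul_neg, neg_neg, mul_assoc]
  have hc2 : Commute (CFC.sqrt (s * s)) a := by
    have hss : 0 ≤ s * s := by
      have := star_mul_self_nonneg s
      rwa [(IsSelfAdjoint.of_nonneg hs).star_eq] at this
    exact Commute.cfcₙ_nnreal hc _
  rw [CFC.sqrt_mul_self s hs] at hc2
  have h2 : s * a = 0 := by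
    rw [← hc2.eq] at h
    have : (2 : ℂ) • (s * a) = 0 := by rw [two_smul]; exact h
    simpa using this
  exact ⟨by rw [h1, h2, neg_zero], h2⟩

lemma mem_AnnIn_iff_of_nonneg {B S : Set A} (hS : ∀ s ∈ S, 0 ≤ s) {a : A} :
    a ∈ AnnIn B S ↔ a ∈ B ∧ ∀ s ∈ S, a * s = 0 ∧ s * a = 0 :=
  ⟨fun h ↦ ⟨h.1, fun s hs ↦ mul_eq_zero_of_anticommute (hS s hs) (h.2 s hs)⟩,
    fun h ↦ ⟨h.1, fun s hs ↦ by rw [(h.2 s hs).1, (h.2 s hs).2, add_zero]⟩⟩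

/-- Anticommuting with all the elements of a star-closed multiplicatively closed set is
orthogonality to that set. -/
lemma mem_AnnIn_iff_of_star_mul {B W : Set A} (hs : ∀ w ∈ W, star w ∈ W)
    (hm : ∀ v ∈ W, ∀ w ∈ W, v * w ∈ W) {a : A} :
    a ∈ AnnIn B W ↔ a ∈ B ∧ ∀ w ∈ W, a * w = 0 ∧ w * a = 0 := by
  refine ⟨fun h ↦ ⟨h.1, fun w hw ↦ ⟨?_, ?_⟩⟩,
    fun h ↦ ⟨h.1, fun s hs ↦ by rw [(h.2 s hs).1, (h.2 s hs).2, add_zero]⟩⟩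
  · exact mul_eq_zero_of_mul_mul_star (mul_eq_zero_of_anticommute (mul_star_self_nonneg w)
      (h.2 _ (hm w hw _ (hs w hw)))).1
  · have := (mul_eq_zero_of_anticommute (star_mul_self_nonneg w)
      (h.2 _ (hm _ (hs w hw) w hw))).2
    apply eq_zero_of_star_mul_self
    rw [star_mul, mul_assoc, ← mul_assoc (star w), this, mul_zero]

variable (C : NonUnitalStarSubalgebra ℂ A) {S : Set A}

lemma star_mem_AnnIn (hS : ∀ s ∈ S, 0 ≤ s) {a : A} (ha : a ∈ AnnIn (C : Set A) S) :
    star a ∈ AnnIn (C : Set A) S := by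
  rw [mem_AnnIn_iff_of_nonneg hS] at ha ⊢
  refine ⟨star_mem (s := C) ha.1, fun s hs ↦ ?_⟩
  have h1 := congrArg star (ha.2 s hs).1
  have h2 := congrArg star (ha.2 s hs).2
  rw [star_mul, star_zero, (IsSelfAdjoint.of_nonneg (hS s hs)).star_eq] at h1 h2
  exact ⟨h2, h1⟩

lemma mul_mem_AnnIn (hS : ∀ s ∈ S, 0 ≤ s) {a b : A} (ha : a ∈ AnnIn (C : Set A) S)
    (hb : b ∈ AnnIn (C : Set A) S) : a * b ∈ AnnIn (C : Set A) S := by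
  rw [mem_AnnIn_iff_of_nonneg hS] at ha hb ⊢
  exact ⟨mul_mem (s := C) ha.1 hb.1, fun s hs ↦
    ⟨by rw [mul_assoc, (hb.2 s hs).1, mul_zero], by rw [← mul_assoc, (ha.2 s hs).2, zero_mul]⟩⟩

lemma mem_AnnIn_AnnIn_iff (hS : ∀ s ∈ S, 0 ≤ s) {a : A} :
    a ∈ AnnIn (C : Set A) (AnnIn (C : Set A) S) ↔
      a ∈ C ∧ ∀ w ∈ AnnIn (C : Set A) S, a * w = 0 ∧ w * a = 0 :=
  mem_AnnIn_iff_of_star_mul (fun _ ↦ star_mem_AnnIn C hS)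
    (fun _ hv _ hw ↦ mul_mem_AnnIn C hS hv hw)

/-- The biannihilator of a set of positive elements, as a star subalgebra. -/
def biannihilator (hS : ∀ s ∈ S, 0 ≤ s) : NonUnitalStarSubalgebra ℂ A where
  carrier := AnnIn (C : Set A) (AnnIn (C : Set A) S)
  add_mem' {a b} ha hb := by
    rw [mem_AnnIn_AnnIn_iff C hS] at *
    exact ⟨add_mem ha.1 hb.1, fun w hw ↦ by
      simp [add_mul, mul_add, ha.2 w hw, hb.2 w hw]⟩
  zero_mem' := by
    rw [mem_AnnIn_AnnIn_iff C hS]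
    exact ⟨zero_mem C, by simp⟩
  mul_mem' {a b} ha hb := by
    rw [mem_AnnIn_AnnIn_iff C hS] at *
    exact ⟨mul_mem ha.1 hb.1, fun w hw ↦
      ⟨by rw [mul_assoc, (hb.2 w hw).1, mul_zero], by rw [← mul_assoc, (ha.2 w hw).2, zero_mul]⟩⟩
  smul_mem' r a ha := by
    rw [mem_AnnIn_AnnIn_iff C hS] at *
    exact ⟨SMulMemClass.smul_mem r ha.1, fun w hw ↦
      ⟨by rw [smul_mul_assoc, (ha.2 w hw).1, smul_zero],
        by rw [mul_smul_comm, (ha.2 w hw).2, smul_zero]⟩⟩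
  star_mem' {a} ha := by
    change a ∈ AnnIn (C : Set A) (AnnIn (C : Set A) S) at ha
    rw [mem_AnnIn_AnnIn_iff C hS] at *
    refine ⟨star_mem ha.1, fun w hw ↦ ?_⟩
    have := ha.2 _ (star_mem_AnnIn C hS hw)
    have h1 := congrArg star this.1
    have h2 := congrArg star this.2
    rw [star_mul, star_zero, star_star] at h1 h2
    exact ⟨h2, h1⟩

lemma coe_biannihilator (hS : ∀ s ∈ S, 0 ≤ s) :
    (biannihilator C hS : Set A) = AnnIn (C : Set A) (AnnIn (C : Set A) S) := rfl

lemma mem_biannihilator (hS : ∀ s ∈ S, 0 ≤ s) {a : A} :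
    a ∈ biannihilator C hS ↔ a ∈ C ∧ ∀ w ∈ AnnIn (C : Set A) S, a * w = 0 ∧ w * a = 0 :=
  mem_AnnIn_AnnIn_iff C hS

lemma isHereditarySub_biannihilator (hS : ∀ s ∈ S, 0 ≤ s) :
    IsHereditarySub (biannihilator (⊤ : NonUnitalStarSubalgebra ℂ A) hS : Set A) := by
  refine ⟨⟨_, rfl⟩, ?_, fun b hb x hx hxb ↦ ?_⟩
  · have : (biannihilator (⊤ : NonUnitalStarSubalgebra ℂ A) hS : Set A) =
        ⋂ w ∈ AnnIn ((⊤ : NonUnitalStarSubalgebra ℂ A) : Set A) S,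
          {a : A | a * w = 0} ∩ {a : A | w * a = 0} := by
      ext a
      simp [mem_biannihilator]
    rw [this]
    exact isClosed_biInter fun w _ ↦
      (isClosed_eq (continuous_id.mul continuous_const) continuous_const).inter
        (isClosed_eq (continuous_const.mul continuous_id) continuous_const)
  · rw [SetLike.mem_coe, mem_biannihilator] at *
    have key : ∀ w ∈ AnnIn ((⊤ : NonUnitalStarSubalgebra ℂ A) : Set A) S, x * w = 0 := by
      intro w hw
      have h0 : star w * x * w = 0 := by
        apply le_antisymm _ (star_left_conjugate_nonneg hx w)
        have := star_left_conjugate_le_conjugate hxb w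
        rwa [mul_assoc _ b, (hb.2 w hw).1, mul_zero] at this
      obtain ⟨y, rfl⟩ := CStarAlgebra.nonneg_iff_eq_star_mul_self.1 hx
      have : y * w = 0 := by
        apply eq_zero_of_star_mul_self
        rw [star_mul, ← h0]
        simp only [mul_assoc]
      rw [mul_assoc, this, mul_zero]
    refine ⟨trivial, fun w hw ↦ ⟨key w hw, ?_⟩⟩
    have := congrArg star (key _ (star_mem_AnnIn _ hS hw))
    rwa [star_mul, star_star, star_zero, (IsSelfAdjoint.of_nonneg hx).star_eq] at this

/-- The intersection of two annihilators is an annihilator. -/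
lemma inter_mem_PAnnIn {Y Z : Set A} (hY : Y ∈ PAnnIn (C : Set A)) (hZ : Z ∈ PAnnIn (C : Set A)) :
    Y ∩ Z ∈ PAnnIn (C : Set A) := by
  obtain ⟨S, hSC, hS, rfl⟩ := hY
  obtain ⟨T, hTC, hT, rfl⟩ := hZ
  set D := biannihilator C hS ⊓ biannihilator C hT
  change (D : Set A) ∈ _
  have hDC : (D : Set A) ⊆ C := fun a ha ↦ ha.1.1
  have hpos : AnnIn (C : Set A) (D : Set A) = AnnIn (C : Set A) {a | a ∈ D ∧ 0 ≤ a} := by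
    refine (AnnIn_antitone fun a ha ↦ ha.1).antisymm fun a ha ↦ ?_
    rw [mem_AnnIn_iff_of_star_mul (fun _ ↦ star_mem (s := D)) fun _ hv _ hw ↦ mul_mem (s := D) hv hw]
    rw [mem_AnnIn_iff_of_nonneg fun s hs ↦ hs.2] at ha
    refine ⟨ha.1, fun w hw ↦ ⟨?_, ?_⟩⟩
    · exact mul_eq_zero_of_mul_mul_star
        (ha.2 _ ⟨mul_mem (s := D) hw (star_mem (s := D) hw), mul_star_self_nonneg w⟩).1
    · have := (ha.2 _ ⟨mul_mem (s := D) (star_mem (s := D) hw) hw, star_mul_self_nonneg w⟩).2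
      apply eq_zero_of_star_mul_self
      rw [star_mul, mul_assoc, ← mul_assoc (star w), this, mul_zero]
  refine ⟨{a | a ∈ D ∧ 0 ≤ a}, fun a ha ↦ hDC ha.1, fun a ha ↦ ha.2, ?_⟩
  rw [← hpos]
  refine (subset_AnnIn_AnnIn hDC).antisymm (Set.subset_inter ?_ ?_)
  · exact (AnnIn_antitone (AnnIn_antitone fun a ha ↦ ha.1)).trans
      (AnnIn_triple_subset AnnIn_subset)
  · exact (AnnIn_antitone (AnnIn_antitone fun a ha ↦ ha.2)).trans
      (AnnIn_triple_subset AnnIn_subset)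

end CStar

section Nonmodular

variable [NonUnitalCStarAlgebra A] [PartialOrder A] [StarOrderedRing A]

lemma assoc_right {R : Type*} [Semigroup R] {x y z : R} (h : x * y = z) (t : R) :
    x * (y * t) = z * t := by rw [← mul_assoc, h]

/-- Two orthogonal equivalent projections `f` and `w * star w` together with a nonunitary
isometry `s` of the corner of `f` yield a pentagon in the lattice of annihilators. -/
theorem not_modularLat_of_isometry (C : NonUnitalStarSubalgebra ℂ A) {f w s : A}
    (hfC : f ∈ C) (hwC : w ∈ C) (hsC : s ∈ C) (hff : f * f = f) (hfs : star f = f)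
    (hfw : f * w = 0) (hwf : w * f = w) (hww : star w * w = f)
    (hsf : s * f = s) (hfs' : f * s = s) (hss : star s * s = f) (hne : s * star s ≠ f) :
    ¬ ModularLat (PAnnIn (C : Set A)) := by
  intro hmod
  have hwf' : star w * f = 0 := by simpa [hfs] using congrArg star hfw
  have hfw' : f * star w = star w := by simpa [hfs] using congrArg star hwf
  have hsf' : f * star s = star s := by simpa [hfs] using congrArg star hsf
  have hfss' : star s * f = star s := by simpa [hfs] using congrArg star hfs'
  have hw2 : w * w = 0 := by nth_rewrite 1 [← hwf]; rw [mul_assoc, hfw, mul_zero]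
  have hsw : s * w = 0 := by rw [← hsf, mul_assoc, hfw, mul_zero]
  -- `k` is the partial isometry from the defect projection of `s` to the corner of `w * star w`
  obtain ⟨k, hk⟩ : ∃ k, k = w - w * (s * star s) := ⟨_, rfl⟩
  -- `c` maps the corner of `f` onto the graph of `s - f`
  obtain ⟨c, hc⟩ : ∃ c, c = f + w * s - w := ⟨_, rfl⟩
  have hkC : k ∈ C := hk ▸ sub_mem hwC (mul_mem hwC (mul_mem hsC (star_mem hsC)))
  have hcC : c ∈ C := hc ▸ sub_mem (add_mem hfC (mul_mem hwC hsC)) hwC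
  have hf0 : 0 ≤ f := hww ▸ star_mul_self_nonneg w
  have hXpos : ∀ x ∈ ({f} : Set A), 0 ≤ x := by simpa using hf0
  have hYpos : ∀ x ∈ ({c * star c} : Set A), 0 ≤ x := by simp
  have hZpos : ∀ x ∈ ({f, k * star k} : Set A), 0 ≤ x := by simpa using hf0
  have hJpos : ∀ x ∈ ({f} ∪ {c * star c} : Set A), 0 ≤ x := by simpa using hf0
  have hXC : ({f} : Set A) ⊆ C := by simpa using hfC
  have hYC : ({c * star c} : Set A) ⊆ C := by simpa using mul_mem hcC (star_mem hcC)
  have hZC : ({f, k * star k} : Set A) ⊆ C := by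
    rintro x (rfl | rfl)
    exacts [hfC, mul_mem hkC (star_mem hkC)]
  have hXP := (⟨_, hXC, hXpos, rfl⟩ :
    AnnIn (C : Set A) (AnnIn (C : Set A) {f}) ∈ PAnnIn (C : Set A))
  have hYP := (⟨_, hYC, hYpos, rfl⟩ :
    AnnIn (C : Set A) (AnnIn (C : Set A) {c * star c}) ∈ PAnnIn (C : Set A))
  have hZP := (⟨_, hZC, hZpos, rfl⟩ :
    AnnIn (C : Set A) (AnnIn (C : Set A) {f, k * star k}) ∈ PAnnIn (C : Set A))
  have hfk : f * k = 0 := by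
    rw [hk, mul_sub, ← mul_assoc, hfw, zero_mul, sub_zero]
  have hkf : star k * f = 0 := by simpa [hfs] using congrArg star hfk
  have hfkk : f * (k * star k) = 0 := by rw [← mul_assoc, hfk, zero_mul]
  have hkkf : k * star k * f = 0 := by rw [mul_assoc, hkf, mul_zero]
  have hkk : k * star k * (k * star k) = k * star k := by
    have : star k * k = f - s * star s := by
      rw [hk]
      simp only [star_sub, star_mul, star_star, sub_mul, mul_sub, mul_assoc, hww,
        assoc_right hww, assoc_right hfs', assoc_right hss, hfss', hsf']
      abel
    have h2 : k * (f - s * star s) = k := by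
      rw [hk]
      simp only [sub_mul, mul_sub, mul_assoc, hwf, hfss', assoc_right hss, hsf']
      abel
    rw [mul_assoc, ← mul_assoc (star k), this, ← mul_assoc, h2]
  have hz : IsProjection (f + k * star k) := by
    constructor
    · rw [add_mul, mul_add, mul_add, hff, hfkk, hkkf, hkk, add_zero, zero_add]
    · rw [star_add, hfs, star_mul, star_star]
  have hzC : f + k * star k ∈ C := add_mem hfC (mul_mem hkC (star_mem hkC))
  -- the join of `X` and `Y` contains `Z`
  have hZJ : AnnIn (C : Set A) (AnnIn (C : Set A) {f, k * star k}) ⊆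
      AnnIn (C : Set A) (AnnIn (C : Set A) ({f} ∪ {c * star c})) := by
    have half : ∀ b ∈ AnnIn (C : Set A) ({f} ∪ {c * star c}), b * (k * star k) = 0 := by
      intro b hb
      rw [mem_AnnIn_iff_of_nonneg hJpos] at hb
      have hbf : b * f = 0 := (hb.2 f (by simp)).1
      have hbc : b * c = 0 := mul_eq_zero_of_mul_mul_star (hb.2 _ (by simp)).1
      obtain ⟨d, hd⟩ : ∃ d, d = b * w := ⟨_, rfl⟩
      have hds : d * s = d := by
        rw [hc, mul_sub, mul_add, hbf, zero_add, ← mul_assoc, ← hd] at hbc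
        exact sub_eq_zero.1 hbc
      have hdf : d * f = d := by rw [hd, mul_assoc, hwf]
      have hsd : star s * star d = star d := by simpa using congrArg star hds
      have hfd : f * star d = star d := by simpa [hfs] using congrArg star hdf
      have h0 : d - d * star s = 0 := by
        apply eq_zero_of_mul_star_self
        simp only [star_sub, star_mul, star_star, mul_sub, sub_mul, mul_assoc, hsd,
          assoc_right hss, hfd, assoc_right hds]
        abel
      have h1 : d * star s = d := (sub_eq_zero.1 h0).symm
      have h2 : b * k = 0 := by
        rw [hk, mul_sub, ← mul_assoc, ← hd, ← mul_assoc, hds, h1, sub_self]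
      rw [← mul_assoc, h2, zero_mul]
    refine AnnIn_antitone fun b hb ↦ ?_
    have hb' := half _ (star_mem_AnnIn C hJpos hb)
    have hb2 := half b hb
    rw [mem_AnnIn_iff_of_nonneg hJpos] at hb
    rw [mem_AnnIn_iff_of_nonneg hZpos]
    refine ⟨hb.1, ?_⟩
    rintro x (rfl | rfl)
    · exact hb.2 _ (by simp)
    · exact ⟨hb2, by simpa [mul_assoc] using congrArg star hb'⟩
  -- the meet of `Y` and `Z` is contained in `X`
  have hYZ : AnnIn (C : Set A) (AnnIn (C : Set A) {c * star c}) ∩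
      AnnIn (C : Set A) (AnnIn (C : Set A) {f, k * star k}) ⊆
      AnnIn (C : Set A) (AnnIn (C : Set A) {f}) := by
    have half : ∀ a ∈ biannihilator C hYpos ⊓ biannihilator C hZpos, f * a = a := by
      rintro a ⟨haY, haZ⟩
      rw [SetLike.mem_coe, mem_biannihilator] at haY haZ
      have hza : (f + k * star k) * a = a := by
        refine projection_mul_of_orthogonal C hz hzC haY.1 fun u hu h1 h2 ↦ ?_
        have huf : u * f = 0 := by
          have := congrArg (· * f) h1
          simpa [add_mul, mul_assoc, mul_add, hff, hkf, hfkk] using this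
        have hfu : f * u = 0 := by
          have := congrArg (f * ·) h2
          simpa [← mul_assoc, mul_add, add_mul, hff, hfk] using this
        refine (haZ.2 u ?_).2
        rw [mem_AnnIn_iff_of_nonneg hZpos]
        refine ⟨hu, ?_⟩
        rintro x (rfl | rfl)
        · exact ⟨huf, hfu⟩
        · rw [mul_add, huf, zero_add] at h1
          rw [add_mul, hfu, zero_add] at h2
          exact ⟨h1, h2⟩
      obtain ⟨b, hb⟩ : ∃ b, b = w * s - w - w * star w := ⟨_, rfl⟩
      have hbC : b ∈ C := hb ▸ sub_mem (sub_mem (mul_mem hwC hsC) hwC)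
        (mul_mem hwC (star_mem hwC))
      have hbc : b * c = 0 := by
        rw [hb, hc]
        simp only [sub_mul, mul_sub, mul_add, mul_assoc, hsf, hwf, hwf', hw2, assoc_right hw2,
          hsw, assoc_right hsw, hww, assoc_right hww, hfs', zero_mul, mul_zero]
        abel
      have hba : b * a = 0 := by
        have h1 : star b * b * a = 0 := by
          refine (haY.2 _ ?_).2
          rw [mem_AnnIn_iff_of_nonneg hYpos]
          refine ⟨mul_mem (s := C) (star_mem (s := C) hbC) hbC, ?_⟩
          rintro x rfl
          refine ⟨by rw [mul_assoc, ← mul_assoc b, hbc, zero_mul, mul_zero], ?_⟩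
          have : star c * star b = 0 := by simpa using congrArg star hbc
          rw [mul_assoc, ← mul_assoc (star c), this, zero_mul, mul_zero]
        apply eq_zero_of_star_mul_self
        rw [star_mul, mul_assoc, ← mul_assoc (star b), h1, mul_zero]
      have hwa : star w * a = s * a - f * a := by
        have := congrArg (star w * ·) hba
        simp only [hb, sub_mul, mul_sub, mul_assoc, assoc_right hww, assoc_right hfs',
          assoc_right hfw', mul_zero] at this
        exact (sub_eq_zero.1 this).symm
      have hska : star s * (star w * a) = 0 := by
        have hkk' : star s * (star w * (k * star k)) = 0 := by
          have : star s * (star w * k) = 0 := by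
            rw [hk]
            simp only [mul_sub, hww, assoc_right hww, assoc_right hfs', assoc_right hss, hfss',
              hsf', sub_self]
          rw [← mul_assoc (star w), ← mul_assoc, this, zero_mul]
        rw [← hza, add_mul, mul_add, ← mul_assoc (star w), hwf', zero_mul, zero_add,
          mul_assoc k]
        have := congrArg (· * a) hkk'
        simpa only [mul_assoc, zero_mul] using this
      have hfa : star s * a = f * a := by
        rw [hwa, mul_sub, assoc_right hss, assoc_right hfss'] at hska
        exact (sub_eq_zero.1 hska).symm
      have hfa' : star a * s = star a * f := by simpa [hfs] using congrArg star hfa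
      have hTa : s * a - f * a = 0 := by
        apply eq_zero_of_star_mul_self
        simp only [star_sub, star_mul, hfs, sub_mul, mul_sub, mul_assoc, assoc_right hss,
          assoc_right hfss', hfa, assoc_right hfs', assoc_right hfa', assoc_right hff]
        abel
      have hka : star k * a = 0 := by
        have : star k = star w - s * star s * star w := by
          rw [hk]; simp [mul_assoc]
        rw [this, sub_mul, mul_assoc, hwa, hTa, mul_zero, sub_zero]
      rwa [add_mul, mul_assoc, hka, mul_zero, add_zero] at hza
    intro a ha
    have h1 := half a ha
    have h2 : a * f = a := by
      simpa [hfs] using congrArg star (half (star a) (star_mem ha))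
    rw [mem_AnnIn_AnnIn_iff C hXpos]
    refine ⟨ha.1.1, fun b hb ↦ ?_⟩
    rw [mem_AnnIn_iff_of_nonneg hXpos] at hb
    obtain ⟨h3, h4⟩ := hb.2 f rfl
    exact ⟨by rw [← h2, mul_assoc, h4, mul_zero], by rw [← h1, ← mul_assoc, h3, zero_mul]⟩
  have hXZ : AnnIn (C : Set A) (AnnIn (C : Set A) {f}) ⊆
      AnnIn (C : Set A) (AnnIn (C : Set A) {f, k * star k}) :=
    AnnIn_antitone (AnnIn_antitone (by simp))
  have heq := hmod _ hXP _ hYP _ hZP hXZ _ _ _ _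
    (isGLBIn_pair_inter (inter_mem_PAnnIn C hYP hZP))
    (isLUBIn_pair_of_subset hXP hYZ)
    (isLUBIn_AnnIn_union hXC hYC hXpos hYpos)
    (isGLBIn_pair_of_subset hZP hZJ)
  have hkX : k * star k ∈ AnnIn (C : Set A) (AnnIn (C : Set A) {f}) :=
    heq ▸ subset_AnnIn_AnnIn hZC (by simp)
  rw [mem_AnnIn_AnnIn_iff C hXpos] at hkX
  have h1 := (hkX.2 (k * star k) (by
    rw [mem_AnnIn_iff_of_nonneg hXpos]
    refine ⟨hkX.1, ?_⟩
    rintro x rfl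
    exact ⟨hkkf, hfkk⟩)).1
  have hk0 : k = 0 := eq_zero_of_mul_star_self (hkk ▸ h1)
  have : star w * k = f - s * star s := by
    rw [hk, mul_sub, hww, ← mul_assoc, hww, ← mul_assoc, hfs']
  rw [hk0, mul_zero] at this
  exact hne (sub_eq_zero.1 this.symm).symm

end Nonmodular

/-- A simple purely infinite C*-algebra is of type III: its lattice `𝒫` of
annihilators is purely nonmodular, i.e. contains no nonzero modular annihilator. -/
theorem stmt_19 {A : Type*} [NonUnitalCStarAlgebra A] [PartialOrder A] [StarOrderedRing A]
    (hsimple : IsSimpleCStar A) (hpi : IsPurelyInfinite A) :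
    ∀ V ∈ PAnn A, ModularLat (PAnnIn V) → V = {0} := by
  intro V hV hmod
  by_contra hV0
  obtain ⟨S, hS, rfl⟩ := hV
  obtain ⟨C, hC⟩ : ∃ C, C = biannihilator (⊤ : NonUnitalStarSubalgebra ℂ A) hS := ⟨_, rfl⟩
  have hCV : Ann (Ann S) = (C : Set A) := by
    rw [hC, coe_biannihilator, Ann_eq_AnnIn_univ, Ann_eq_AnnIn_univ]
    rfl
  rw [hCV] at hmod hV0
  obtain ⟨p, hpC, ⟨hpp, hps⟩, q, ⟨hqq, hqs⟩, hqp, hpq, hqne, x, hxp, hxq⟩ :=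
    hpi C (hC ▸ isHereditarySub_biannihilator hS) hV0
  have hpC : p ∈ C := hpC
  have hpx : p * x = x := by
    have : x - p * x = 0 := by
      apply eq_zero_of_mul_star_self
      simp only [star_sub, star_mul, mul_sub, sub_mul, hps, mul_assoc, hxp, assoc_right hxp,
        hpp]
      abel
    exact (sub_eq_zero.1 this).symm
  have hxq' : x * q = x := by rw [← hxq, ← mul_assoc, hxp, hpx]
  have hxp' : x * p = x := by rw [← hxq', mul_assoc, hqp]
  have corner : ∀ y : A, p * y = y → y * p = y → y ∈ C := by
    intro y h1 h2
    rw [hC, mem_biannihilator] at hpC ⊢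
    exact ⟨trivial, fun w hw ↦ ⟨by rw [← h2, mul_assoc, (hpC.2 w hw).1, mul_zero],
      by rw [← h1, ← mul_assoc, (hpC.2 w hw).2, zero_mul]⟩⟩
  have hxC : x ∈ C := corner x hpx hxp'
  obtain ⟨e, he⟩ : ∃ e, e = p - q := ⟨_, rfl⟩
  have hee : IsProjection e := by
    constructor
    · rw [he, sub_mul, mul_sub, mul_sub, hpp, hpq, hqp, hqq, sub_self, sub_zero]
    · rw [he, star_sub, hps, hqs]
  have he0 : e ≠ 0 := fun h ↦ hqne (sub_eq_zero.1 (he ▸ h)).symm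
  have hepos : ∀ y ∈ ({e} : Set A), 0 ≤ y := by
    rintro y rfl
    have := star_mul_self_nonneg y
    rwa [hee.2, hee.1] at this
  obtain ⟨f, hfE, ⟨hff, hfs⟩, g, ⟨hgg, hgs⟩, hgf, hfg, hgne, y, hyf, hyg⟩ :=
    hpi _ (isHereditarySub_biannihilator (S := {e}) hepos) fun h ↦ he0 <| by
      have : e ∈ ({0} : Set A) := h ▸ subset_AnnIn_AnnIn (B := Set.univ) (by simp) rfl
      simpa using this
  have hef : e * f = f := by
    rw [SetLike.mem_coe, mem_biannihilator] at hfE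
    refine projection_mul_of_orthogonal ⊤ hee trivial trivial fun u _ h1 h2 ↦ (hfE.2 u ?_).2
    rw [mem_AnnIn_iff_of_nonneg hepos]
    refine ⟨trivial, ?_⟩
    rintro z rfl
    exact ⟨h1, h2⟩
  have hfe : f * e = f := by simpa [hfs, hee.2] using congrArg star hef
  have hpf : p * f = f := by
    rw [← hef, ← mul_assoc, he, mul_sub, hpp, hpq]
  have hfp : f * p = f := by simpa [hfs, hps] using congrArg star hpf
  have hfq : f * q = 0 := by
    rw [← hfe, mul_assoc, he, sub_mul, hpq, hqq, sub_self, mul_zero]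
  have hqx : q * star x = star x := by simpa [hqs] using congrArg star hxq'
  have hfC : f ∈ C := corner f hpf hfp
  have hfy : f * y = y := by
    have : y - f * y = 0 := by
      apply eq_zero_of_mul_star_self
      simp only [star_sub, star_mul, mul_sub, sub_mul, hfs, mul_assoc, hyf, assoc_right hyf,
        hff]
      abel
    exact (sub_eq_zero.1 this).symm
  have hyg' : y * g = y := by rw [← hyg, ← mul_assoc, hyf, hfy]
  have hyf' : y * f = y := by rw [← hyg', mul_assoc, hgf]
  have hyC : y ∈ C := corner y (by rw [← hfy, ← mul_assoc, hpf]) (by rw [← hyf', mul_assoc, hfp])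
  refine not_modularLat_of_isometry C (f := f) (w := star x * f) (s := star y) hfC
    (mul_mem (star_mem hxC) hfC) (star_mem hyC) hff hfs ?_ ?_ ?_ ?_ ?_ ?_ ?_ hmod
  · rw [← hqx, mul_assoc, ← mul_assoc, hfq, zero_mul]
  · rw [mul_assoc, hff]
  · rw [star_mul, star_star, hfs, mul_assoc, ← mul_assoc x, hxp, hpf, hff]
  · simpa [hfs] using congrArg star hfy
  · simpa [hfs] using congrArg star hyf'
  · rw [star_star, hyf]
  · rw [star_star, hyg]
    exact hgne
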